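/- arXiv:1903.07940 — 10 statements merged into one kernel-verified Lean document; each statement's English description precedes it below -/
import Mathlib

section
/- Let n, T be positive integers, θ0 ∈ ℝ^n, ε ∈ (0,1), and for each t ∈ {1,…,T} let A_t ∈ ℝ be an advantage and r_t : ℝ^n → ℝ a likelihood-ratio function that is differentiable at θ0 with |r_t(θ0) − 1| ≠ ε. Fix an index t such that either (r_t(θ0) > 1+ε and A_t > 0) or (r_t(θ0) < 1−ε and A_t < 0). If ⟨∇L^CLIP(θ0), ∇r_t(θ0)⟩ · A_t > 0, then there exists β̄ > 0 such that for every β ∈ (0, β̄), |r_t(θ0 + β·∇L^CLIP(θ0)) − 1| > |r_t(θ0) − 1| > ε. (That is, a gradient step on the PPO clipped objective can push an already out-of-range likelihood ratio even farther beyond the clipping range.) -/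
open RealInnerProductSpace

/-- PPO clipping function: clip(r, ε) = max(1-ε, min(1+ε, r)). -/
noncomputable def ppoClip (r ε : ℝ) : ℝ := max (1 - ε) (min (1 + ε) r)

/-- Overall PPO clipped surrogate objective. -/
noncomputable def LCLIP {n T : ℕ} (ε : ℝ) (A : Fin T → ℝ)
    (r : Fin T → EuclideanSpace ℝ (Fin n) → ℝ) (θ : EuclideanSpace ℝ (Fin n)) : ℝ :=
  ∑ t, min (r t θ * A t) (ppoClip (r t θ) ε * A t)

/-- A function strictly increases for small positive steps along a direction in which its
derivative is positive. -/
theorem HasFDerivAt.eventually_lt_add_smul {E : Type*} [NormedAddCommGroup E] [NormedSpace ℝ E]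
    {g : E → ℝ} {g' : E →L[ℝ] ℝ} {x v : E} (hg : HasFDerivAt g g' x) (hv : 0 < g' v) :
    ∀ᶠ β in nhdsWithin (0 : ℝ) (Set.Ioi 0), g x < g (x + β • v) := by
  have hslope := (hg.hasLineDerivAt v).tendsto_slope_zero_right
  filter_upwards [hslope.eventually_const_lt hv, self_mem_nhdsWithin] with β hβ hpos
  have hinv : 0 < β⁻¹ := inv_pos.mpr hpos
  simp only [smul_eq_mul] at hβ
  exact sub_pos.mp (pos_of_mul_pos_right hβ hinv.le)

/-- A gradient step on the PPO clipped objective can push an already out-of-range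
likelihood ratio even farther beyond the clipping range. -/
theorem ppo_pushes_ratio_farther (n T : ℕ) (hn : 0 < n) (hT : 0 < T)
    (θ0 : EuclideanSpace ℝ (Fin n)) (ε : ℝ) (hε : ε ∈ Set.Ioo (0 : ℝ) 1)
    (A : Fin T → ℝ) (r : Fin T → EuclideanSpace ℝ (Fin n) → ℝ)
    (hdiff : ∀ t, DifferentiableAt ℝ (r t) θ0)
    (hne : ∀ t, |r t θ0 - 1| ≠ ε)
    (t : Fin T)
    (ht : (1 + ε < r t θ0 ∧ 0 < A t) ∨ (r t θ0 < 1 - ε ∧ A t < 0))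
    (hcond : ⟪gradient (LCLIP ε A r) θ0, gradient (r t) θ0⟫ * A t > 0) :
    ∃ βbar > (0 : ℝ), ∀ β ∈ Set.Ioo (0 : ℝ) βbar,
      |r t (θ0 + β • gradient (LCLIP ε A r) θ0) - 1| > |r t θ0 - 1| ∧
      |r t θ0 - 1| > ε := by
  have hpos := hε.1
  set v := gradient (LCLIP ε A r) θ0
  have hinner : fderiv ℝ (r t) θ0 v = ⟪v, gradient (r t) θ0⟫ := by
    rw [real_inner_comm, gradient, InnerProductSpace.toDual_symm_apply]
  have hr := (hdiff t).hasFDerivAt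
  rw [← hinner] at hcond
  suffices hev : ∀ᶠ β in nhdsWithin (0 : ℝ) (Set.Ioi 0),
      |r t (θ0 + β • v) - 1| > |r t θ0 - 1| ∧ |r t θ0 - 1| > ε by
    obtain ⟨βbar, hβbar, hsub⟩ := mem_nhdsGT_iff_exists_Ioo_subset.mp hev
    exact ⟨βbar, hβbar, fun β hβ => hsub hβ⟩
  rcases ht with ⟨hout, hA⟩ | ⟨hout, hA⟩
  · have hv : 0 < fderiv ℝ (r t) θ0 v := pos_of_mul_pos_left hcond hA.le
    filter_upwards [hr.eventually_lt_add_smul hv] with β hβ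
    rw [abs_of_pos (by linarith : 0 < r t θ0 - 1), abs_of_pos (by linarith)]
    constructor <;> linarith
  · have hv : 0 < (-fderiv ℝ (r t) θ0) v := by
      simpa using neg_of_mul_pos_left hcond hA.le
    filter_upwards [hr.neg.eventually_lt_add_smul hv] with β hβ
    simp only [Pi.neg_apply] at hβ
    rw [abs_of_neg (by linarith : r t θ0 - 1 < 0), abs_of_neg (by linarith)]
    constructor <;> linarith
end

section
/- Let n, T be positive integers, θ0 ∈ ℝ^n, ε ∈ (0,1), α > 0, and for each t ∈ {1,…,T} let A_t ∈ ℝ and r_t : ℝ^n → ℝ be differentiable at θ0 with |r_t(θ0) − 1| ≠ ε. Then both L^CLIP and L^RB are differentiable at θ0 and ∇L^RB(θ0) − ∇L^CLIP(θ0) = −α · Σ_{t ∈ Ω} A_t · ∇r_t(θ0), where Ω = { t : |r_t(θ0) − 1| > ε and r_t(θ0)·A_t ≥ A_t } is the set of indices satisfying the clipping condition at θ0. -/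
open RealInnerProductSpace

/-- Rollback function. -/
noncomputable def FRB (r ε α : ℝ) : ℝ :=
  if r ≤ 1 - ε then -α * r + (1 + α) * (1 - ε)
  else if 1 + ε ≤ r then -α * r + (1 + α) * (1 + ε)
  else r

/-- Overall rollback surrogate objective. -/
noncomputable def LRB {n T : ℕ} (ε α : ℝ) (A : Fin T → ℝ)
    (r : Fin T → EuclideanSpace ℝ (Fin n) → ℝ) (θ : EuclideanSpace ℝ (Fin n)) : ℝ :=
  ∑ t, min (r t θ * A t) (FRB (r t θ) ε α * A t)

/-- Away from the clipping boundary, the two surrogates of a single sample are differentiable in the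
likelihood ratio, and their derivatives differ by `α * A` exactly under the clipping condition. -/
lemma exists_hasDerivAt_min_ppoClip_FRB {ε α x : ℝ} (A : ℝ) (hε : 0 < ε) (hα : 0 < α)
    (hx : |x - 1| ≠ ε) :
    ∃ c, HasDerivAt (fun y => min (y * A) (ppoClip y ε * A)) c x ∧
      HasDerivAt (fun y => min (y * A) (FRB y ε α * A))
        (c - if ε < |x - 1| ∧ A ≤ x * A then α * A else 0) x := by
  have hlin : HasDerivAt (fun y : ℝ => y * A) A x := by
    simpa using (hasDerivAt_id x).mul_const A
  have hroll (b : ℝ) : HasDerivAt (fun y : ℝ => (-α * y + b) * A) (-(α * A)) x := by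
    simpa using (((hasDerivAt_id x).const_mul (-α)).add_const b).mul_const A
  rcases lt_or_gt_of_ne hx with h | h
  · obtain ⟨h1, h2⟩ := abs_lt.mp h
    have hnear : ∀ᶠ y in nhds x, y ∈ Set.Ioo (1 - ε) (1 + ε) :=
      Ioo_mem_nhds (by linarith) (by linarith)
    refine ⟨A, hlin.congr_of_eventuallyEq ?_, ?_⟩
    · filter_upwards [hnear] with y hy
      simp [ppoClip, min_eq_right hy.2.le, max_eq_right hy.1.le]
    · rw [if_neg fun hc => lt_asymm h hc.1, sub_zero]
      refine hlin.congr_of_eventuallyEq ?_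
      filter_upwards [hnear] with y hy
      simp [FRB, not_le.mpr hy.1, not_le.mpr hy.2]
  · rcases lt_abs.mp h with h' | h'
    · have hnear : ∀ᶠ y in nhds x, 1 + ε < y := lt_mem_nhds (by linarith)
      have hclip {y : ℝ} (hy : 1 + ε < y) : ppoClip y ε = 1 + ε := by
        rw [ppoClip, min_eq_left hy.le, max_eq_right (by linarith)]
      have hrb {y : ℝ} (hy : 1 + ε < y) : FRB y ε α = -α * y + (1 + α) * (1 + ε) := by
        rw [FRB, if_neg (by linarith), if_pos hy.le]
      rcases le_or_gt 0 A with hA | hA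
      · refine ⟨0, (hasDerivAt_const x ((1 + ε) * A)).congr_of_eventuallyEq ?_, ?_⟩
        · filter_upwards [hnear] with y hy
          rw [hclip hy]
          exact min_eq_right (mul_le_mul_of_nonneg_right hy.le hA)
        · rw [if_pos ⟨h, by nlinarith⟩, zero_sub]
          refine (hroll ((1 + α) * (1 + ε))).congr_of_eventuallyEq ?_
          filter_upwards [hnear] with y hy
          rw [hrb hy]
          exact min_eq_right (mul_le_mul_of_nonneg_right (by nlinarith) hA)
      · refine ⟨A, hlin.congr_of_eventuallyEq ?_, ?_⟩
        · filter_upwards [hnear] with y hy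
          rw [hclip hy]
          exact min_eq_left (mul_le_mul_of_nonpos_right hy.le hA.le)
        · rw [if_neg fun hc => by nlinarith [hc.2], sub_zero]
          refine hlin.congr_of_eventuallyEq ?_
          filter_upwards [hnear] with y hy
          rw [hrb hy]
          exact min_eq_left (mul_le_mul_of_nonpos_right (by nlinarith) hA.le)
    · have hnear : ∀ᶠ y in nhds x, y < 1 - ε := gt_mem_nhds (by linarith)
      have hclip {y : ℝ} (hy : y < 1 - ε) : ppoClip y ε = 1 - ε :=
        max_eq_left ((min_le_right _ _).trans hy.le)
      have hrb {y : ℝ} (hy : y < 1 - ε) : FRB y ε α = -α * y + (1 + α) * (1 - ε) :=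
        if_pos hy.le
      rcases lt_or_ge 0 A with hA | hA
      · refine ⟨A, hlin.congr_of_eventuallyEq ?_, ?_⟩
        · filter_upwards [hnear] with y hy
          rw [hclip hy]
          exact min_eq_left (mul_le_mul_of_nonneg_right hy.le hA.le)
        · rw [if_neg fun hc => by nlinarith [hc.2], sub_zero]
          refine hlin.congr_of_eventuallyEq ?_
          filter_upwards [hnear] with y hy
          rw [hrb hy]
          exact min_eq_left (mul_le_mul_of_nonneg_right (by nlinarith) hA.le)
      · refine ⟨0, (hasDerivAt_const x ((1 - ε) * A)).congr_of_eventuallyEq ?_, ?_⟩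
        · filter_upwards [hnear] with y hy
          rw [hclip hy]
          exact min_eq_right (mul_le_mul_of_nonpos_right hy.le hA)
        · rw [if_pos ⟨h, by nlinarith⟩, zero_sub]
          refine (hroll ((1 + α) * (1 - ε))).congr_of_eventuallyEq ?_
          filter_upwards [hnear] with y hy
          rw [hrb hy]
          exact min_eq_right (mul_le_mul_of_nonpos_right (by nlinarith) hA)

/-- Gradient of a sum of scalar functions composed with real-valued differentiable functions. -/
lemma hasGradientAt_sum_comp {ι E : Type*} [Fintype ι] [NormedAddCommGroup E]
    [InnerProductSpace ℝ E] [CompleteSpace E] {x : E} {φ : ι → ℝ → ℝ} {c : ι → ℝ}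
    {r : ι → E → ℝ} (hr : ∀ t, DifferentiableAt ℝ (r t) x)
    (hφ : ∀ t, HasDerivAt (φ t) (c t) (r t x)) :
    HasGradientAt (fun y => ∑ t, φ t (r t y)) (∑ t, c t • gradient (r t) x) x := by
  rw [hasGradientAt_iff_hasFDerivAt, map_sum]
  refine HasFDerivAt.fun_sum fun t _ => ?_
  have hmap : InnerProductSpace.toDual ℝ E (c t • gradient (r t) x) =
      c t • InnerProductSpace.toDual ℝ E (gradient (r t) x) := by simp
  rw [hmap]
  exact (hφ t).comp_hasFDerivAt x (hr t).hasGradientAt.hasFDerivAt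

/-- The gradients of the rollback objective and the PPO clipped objective differ exactly by
`-α • ∑_{t ∈ Ω} A_t • ∇r_t(θ0)` over the set Ω of clipped samples. -/
theorem grad_LRB_sub_grad_LCLIP (n T : ℕ) (hn : 0 < n) (hT : 0 < T)
    (θ0 : EuclideanSpace ℝ (Fin n)) (ε : ℝ) (hε : ε ∈ Set.Ioo (0 : ℝ) 1)
    (α : ℝ) (hα : 0 < α)
    (A : Fin T → ℝ) (r : Fin T → EuclideanSpace ℝ (Fin n) → ℝ)
    (hdiff : ∀ t, DifferentiableAt ℝ (r t) θ0)
    (hne : ∀ t, |r t θ0 - 1| ≠ ε) :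
    DifferentiableAt ℝ (LCLIP ε A r) θ0 ∧
    DifferentiableAt ℝ (LRB ε α A r) θ0 ∧
    gradient (LRB ε α A r) θ0 - gradient (LCLIP ε A r) θ0 =
      -α • ∑ t ∈ Finset.univ.filter
          (fun t => ε < |r t θ0 - 1| ∧ A t ≤ r t θ0 * A t),
        A t • gradient (r t) θ0 := by
  choose c hclip hrb using fun t =>
    exists_hasDerivAt_min_ppoClip_FRB (A t) hε.1 hα (hne t)
  have hCLIP : HasGradientAt (LCLIP ε A r) _ θ0 := hasGradientAt_sum_comp hdiff hclip
  have hRB : HasGradientAt (LRB ε α A r) _ θ0 := hasGradientAt_sum_comp hdiff hrb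
  refine ⟨hCLIP.differentiableAt, hRB.differentiableAt, ?_⟩
  rw [hCLIP.gradient, hRB.gradient, ← Finset.sum_sub_distrib, Finset.smul_sum, Finset.sum_filter]
  refine Finset.sum_congr rfl fun t _ => ?_
  split_ifs <;> module
end

section
/- Let n, T be positive integers, θ0 ∈ ℝ^n, ε ∈ (0,1), α > 0, and for each t ∈ {1,…,T} let A_t ∈ ℝ and r_t : ℝ^n → ℝ be differentiable at θ0 with |r_t(θ0) − 1| ≠ ε. Let Ω = { t : |r_t(θ0) − 1| > ε and r_t(θ0)·A_t ≥ A_t }. Define θ1^CLIP(β) = θ0 + β·∇L^CLIP(θ0) and θ1^RB(β) = θ0 + β·∇L^RB(θ0). Fix t ∈ Ω with A_t ≠ 0. If Σ_{t' ∈ Ω} ⟨∇r_t(θ0), ∇r_{t'}(θ0)⟩ · A_t · A_{t'} > 0, then there exists β̄ > 0 such that for every β ∈ (0, β̄), |r_t(θ1^RB(β)) − 1| < |r_t(θ1^CLIP(β)) − 1|. (That is, the rollback objective keeps the out-of-range likelihood ratio closer to 1 than the PPO clipped objective does.) -/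
open RealInnerProductSpace

/-- Away from the clipping boundary the two per-sample surrogates are differentiable in the
ratio, and their derivatives differ by `α * a` exactly when clipping is active. -/
theorem exists_hasDerivAt_surrogates {ε α a x : ℝ} (hε : 0 < ε) (hα : 0 < α)
    (hx : |x - 1| ≠ ε) :
    ∃ c : ℝ, HasDerivAt (fun y => min (y * a) (ppoClip y ε * a)) c x ∧
      HasDerivAt (fun y => min (y * a) (FRB y ε α * a))
        (c - if ε < |x - 1| ∧ a ≤ x * a then α * a else 0) x := by
  have hid : HasDerivAt (fun y : ℝ => y * a) a x := by
    simpa using (hasDerivAt_id x).mul_const a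
  have hroll (b : ℝ) : HasDerivAt (fun y : ℝ => (-α * y + b) * a) (0 - α * a) x := by
    simpa using (((hasDerivAt_id x).const_mul (-α)).add_const b).mul_const a
  rcases lt_or_gt_of_ne hx with h | h
  · obtain ⟨h1, h2⟩ := abs_lt.mp h
    have hI : Set.Ioo (1 - ε) (1 + ε) ∈ nhds x := Ioo_mem_nhds (by linarith) (by linarith)
    refine ⟨a, hid.congr_of_eventuallyEq ?_, ?_⟩
    · filter_upwards [hI] with y hy
      rw [ppoClip, min_eq_right hy.2.le, max_eq_right hy.1.le, min_self]
    · rw [if_neg (fun hc => lt_asymm h hc.1), sub_zero]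
      refine hid.congr_of_eventuallyEq ?_
      filter_upwards [hI] with y hy
      rw [FRB, if_neg (not_le.mpr hy.1), if_neg (not_le.mpr hy.2), min_self]
  · rcases lt_abs.mp h with h' | h'
    · have hI : Set.Ioi (1 + ε) ∈ nhds x := Ioi_mem_nhds (by linarith)
      have hclip {y : ℝ} (hy : 1 + ε < y) : ppoClip y ε = 1 + ε := by
        rw [ppoClip, min_eq_left hy.le, max_eq_right (by linarith)]
      have hrb {y : ℝ} (hy : 1 + ε < y) : FRB y ε α = -α * y + (1 + α) * (1 + ε) := by
        rw [FRB, if_neg (by linarith), if_pos hy.le]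
      have hle {y : ℝ} (hy : 1 + ε < y) : -α * y + (1 + α) * (1 + ε) ≤ y := by nlinarith
      rcases le_or_gt 0 a with ha | ha
      · rw [if_pos ⟨h, by nlinarith⟩]
        refine ⟨0, (hasDerivAt_const x ((1 + ε) * a)).congr_of_eventuallyEq ?_,
          (hroll ((1 + α) * (1 + ε))).congr_of_eventuallyEq ?_⟩
        · filter_upwards [hI] with y hy
          rw [hclip hy, min_eq_right (mul_le_mul_of_nonneg_right (le_of_lt hy) ha)]
        · filter_upwards [hI] with y hy
          rw [hrb hy, min_eq_right (mul_le_mul_of_nonneg_right (hle hy) ha)]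
      · rw [if_neg (fun hc => by nlinarith [hc.2])]
        simp only [sub_zero]
        refine ⟨a, hid.congr_of_eventuallyEq ?_, hid.congr_of_eventuallyEq ?_⟩
        · filter_upwards [hI] with y hy
          rw [hclip hy, min_eq_left (mul_le_mul_of_nonpos_right (le_of_lt hy) ha.le)]
        · filter_upwards [hI] with y hy
          rw [hrb hy, min_eq_left (mul_le_mul_of_nonpos_right (hle hy) ha.le)]
    · have hI : Set.Iio (1 - ε) ∈ nhds x := Iio_mem_nhds (by linarith)
      have hclip {y : ℝ} (hy : y < 1 - ε) : ppoClip y ε = 1 - ε := by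
        rw [ppoClip, max_eq_left ((min_le_right _ _).trans hy.le)]
      have hrb {y : ℝ} (hy : y < 1 - ε) : FRB y ε α = -α * y + (1 + α) * (1 - ε) := by
        rw [FRB, if_pos hy.le]
      have hle {y : ℝ} (hy : y < 1 - ε) : y ≤ -α * y + (1 + α) * (1 - ε) := by nlinarith
      rcases le_or_gt a 0 with ha | ha
      · rw [if_pos ⟨h, by nlinarith⟩]
        refine ⟨0, (hasDerivAt_const x ((1 - ε) * a)).congr_of_eventuallyEq ?_,
          (hroll ((1 + α) * (1 - ε))).congr_of_eventuallyEq ?_⟩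
        · filter_upwards [hI] with y hy
          rw [hclip hy, min_eq_right (mul_le_mul_of_nonpos_right (le_of_lt hy) ha)]
        · filter_upwards [hI] with y hy
          rw [hrb hy, min_eq_right (mul_le_mul_of_nonpos_right (hle hy) ha)]
      · rw [if_neg (fun hc => by nlinarith [hc.2])]
        simp only [sub_zero]
        refine ⟨a, hid.congr_of_eventuallyEq ?_, hid.congr_of_eventuallyEq ?_⟩
        · filter_upwards [hI] with y hy
          rw [hclip hy, min_eq_left (mul_le_mul_of_nonneg_right (le_of_lt hy) ha.le)]
        · filter_upwards [hI] with y hy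
          rw [hrb hy, min_eq_left (mul_le_mul_of_nonneg_right (hle hy) ha.le)]

/-- Chain rule for the gradient of a finite sum of scalar functions of differentiable maps. -/
theorem gradient_sum_comp {ι E : Type*} [Fintype ι] [NormedAddCommGroup E]
    [InnerProductSpace ℝ E] [CompleteSpace E] {r : ι → E → ℝ} {x : E} {f : ι → ℝ → ℝ}
    {c : ι → ℝ} (hr : ∀ i, DifferentiableAt ℝ (r i) x)
    (hf : ∀ i, HasDerivAt (f i) (c i) (r i x)) :
    gradient (fun y => ∑ i, f i (r i y)) x = ∑ i, c i • gradient (r i) x := by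
  have h : HasFDerivAt (fun y => ∑ i, f i (r i y)) (∑ i, c i • fderiv ℝ (r i) x) x :=
    HasFDerivAt.fun_sum fun i _ => (hf i).comp_hasFDerivAt x (hr i).hasFDerivAt
  simp [gradient, h.fderiv]

/-- A function with negative derivative at `0` and value `0` there is negative just to the
right of `0`. -/
theorem eventually_neg_of_hasDerivAt_neg {f : ℝ → ℝ} {d : ℝ} (hf : HasDerivAt f d 0)
    (h0 : f 0 = 0) (hd : d < 0) : ∀ᶠ β in nhdsWithin 0 (Set.Ioi 0), f β < 0 := by
  have h := (hf.tendsto_slope.mono_left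
    (nhdsWithin_mono 0 fun y (hy : 0 < y) => hy.ne')).eventually_lt_const hd
  filter_upwards [h, self_mem_nhdsWithin] with β hβ hpos
  have hpos : 0 < β := hpos
  rw [slope_def_field, h0, sub_zero, sub_zero, div_lt_iff₀ hpos, zero_mul] at hβ
  exact hβ

/-- After a (small) gradient step, the rollback objective keeps the out-of-range likelihood
ratio closer to 1 than the PPO clipped objective does. -/
theorem rollback_closer_than_clip (n T : ℕ) (hn : 0 < n) (hT : 0 < T)
    (θ0 : EuclideanSpace ℝ (Fin n)) (ε : ℝ) (hε : ε ∈ Set.Ioo (0 : ℝ) 1)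
    (α : ℝ) (hα : 0 < α)
    (A : Fin T → ℝ) (r : Fin T → EuclideanSpace ℝ (Fin n) → ℝ)
    (hdiff : ∀ t, DifferentiableAt ℝ (r t) θ0)
    (hne : ∀ t, |r t θ0 - 1| ≠ ε)
    (Ω : Finset (Fin T))
    (hΩ : Ω = Finset.univ.filter (fun t => ε < |r t θ0 - 1| ∧ A t ≤ r t θ0 * A t))
    (t : Fin T) (htΩ : t ∈ Ω) (hAt : A t ≠ 0)
    (hcond : 0 < ∑ t' ∈ Ω, ⟪gradient (r t) θ0, gradient (r t') θ0⟫ * A t * A t') :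
    ∃ βbar > (0 : ℝ), ∀ β ∈ Set.Ioo (0 : ℝ) βbar,
      |r t (θ0 + β • gradient (LRB ε α A r) θ0) - 1| <
        |r t (θ0 + β • gradient (LCLIP ε A r) θ0) - 1| := by
  have hε0 := hε.1
  choose c hclip hrb using fun s =>
    exists_hasDerivAt_surrogates (a := A s) hε0 hα (hne s)
  have hgrad : gradient (LRB ε α A r) θ0 - gradient (LCLIP ε A r) θ0 =
      -(α • ∑ s ∈ Ω, A s • gradient (r s) θ0) := by
    have h1 : gradient (LCLIP ε A r) θ0 = _ := gradient_sum_comp hdiff hclip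
    have h2 : gradient (LRB ε α A r) θ0 = _ := gradient_sum_comp hdiff hrb
    rw [h1, h2, hΩ, Finset.sum_filter, ← Finset.sum_sub_distrib, Finset.smul_sum,
      ← Finset.sum_neg_distrib]
    refine Finset.sum_congr rfl fun s _ => ?_
    split_ifs <;> module
  set u := gradient (LRB ε α A r) θ0
  set v := gradient (LCLIP ε A r) θ0
  have hline (w : EuclideanSpace ℝ (Fin n)) :
      HasDerivAt (fun β : ℝ => r t (θ0 + β • w)) ⟪gradient (r t) θ0, w⟫ 0 := by
    have h := (hdiff t).hasGradientAt.hasFDerivAt.hasLineDerivAt w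
    simpa [HasLineDerivAt] using h
  have hslope : A t * (⟪gradient (r t) θ0, u⟫ - ⟪gradient (r t) θ0, v⟫) < 0 := by
    have hsum : ∑ s ∈ Ω, ⟪gradient (r t) θ0, gradient (r s) θ0⟫ * A t * A s =
        A t * ⟪gradient (r t) θ0, ∑ s ∈ Ω, A s • gradient (r s) θ0⟫ := by
      rw [inner_sum, Finset.mul_sum]
      refine Finset.sum_congr rfl fun s _ => ?_
      rw [real_inner_smul_right]
      ring
    rw [hsum] at hcond
    rw [← inner_sub_right, hgrad, inner_neg_right, real_inner_smul_right]
    nlinarith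
  have hpos : 0 < A t * (r t θ0 - 1) := by
    rw [hΩ, Finset.mem_filter] at htΩ
    obtain ⟨-, hout, hle⟩ := htΩ
    have hne1 : r t θ0 - 1 ≠ 0 := abs_pos.mp (hε0.trans hout)
    exact lt_of_le_of_ne (by linarith) (mul_ne_zero hAt hne1).symm
  have hside (w : EuclideanSpace ℝ (Fin n)) :
      ∀ᶠ β in nhdsWithin (0 : ℝ) (Set.Ioi 0), 0 < A t * (r t (θ0 + β • w) - 1) := by
    refine Filter.Eventually.filter_mono nhdsWithin_le_nhds ?_
    have hcont := (((hline w).sub_const 1).const_mul (A t)).continuousAt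
    exact hcont.eventually_const_lt (by simpa using hpos)
  have hlt := eventually_neg_of_hasDerivAt_neg
    (((hline u).sub (hline v)).const_mul (A t)) (by simp) hslope
  obtain ⟨b, hb, hsub⟩ := mem_nhdsGT_iff_exists_Ioo_subset.mp
    ((hside u).and ((hside v).and hlt))
  refine ⟨b, hb, fun β hβ => ?_⟩
  obtain ⟨hu, hv, huv⟩ := hsub hβ
  have habs : |A t| * |r t (θ0 + β • u) - 1| < |A t| * |r t (θ0 + β • v) - 1| := by
    rw [← abs_mul, ← abs_mul, abs_of_pos hu, abs_of_pos hv]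
    simp only [Pi.sub_apply] at huv
    linarith
  exact lt_of_mul_lt_mul_left habs (abs_nonneg _)
end

section
/- Let D be a finite set with |D| ≥ 3, let a ∈ D, let ε ∈ (0,1), and let p_old be a probability vector on D with p_old(d) > 0 for every d ∈ D. Then the KL divergence over the likelihood-ratio-constrained set is unbounded above: for every M ∈ ℝ there exists a probability vector p on D with p(d) > 0 for every d ∈ D and 1−ε ≤ p(a)/p_old(a) ≤ 1+ε, such that Σ_{d∈D} p_old(d)·log(p_old(d)/p(d)) > M. -/
/-- The tangent-line bound `x - y ≤ x * log (x / y)` for positive reals. -/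
theorem sub_le_mul_log_div {x y : ℝ} (hx : 0 < x) (hy : 0 < y) :
    x - y ≤ x * Real.log (x / y) := by
  have h := mul_le_mul_of_nonneg_left (Real.one_sub_inv_le_log_of_pos (div_pos hx hy)) hx.le
  rwa [inv_div, mul_sub, mul_one, mul_div_cancel₀ _ hx.ne'] at h

/-- On a finite action set with at least 3 actions, the KL divergence from the old
probability vector is unbounded above over the set of strictly positive probability
vectors satisfying the PPO likelihood-ratio constraint at a fixed action `a`. -/
theorem kl_unbounded_discrete (D : Type*) [Fintype D] (hcard : 3 ≤ Fintype.card D)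
    (a : D) (ε : ℝ) (hε : ε ∈ Set.Ioo (0 : ℝ) 1)
    (pold : D → ℝ) (hpos : ∀ d, 0 < pold d) (hsum : ∑ d, pold d = 1) :
    ∀ M : ℝ, ∃ p : D → ℝ, (∀ d, 0 < p d) ∧ (∑ d, p d = 1) ∧
      1 - ε ≤ p a / pold a ∧ p a / pold a ≤ 1 + ε ∧
      ∑ d, pold d * Real.log (pold d / p d) > M := by
  classical
  intro M
  obtain ⟨b, hba⟩ : ∃ b, b ∉ ({a} : Finset D) := by
    by_contra! h
    have := (Finset.card_le_card fun d _ => h d : Finset.univ.card ≤ _)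
    simp only [Finset.card_univ, Finset.card_singleton] at this
    omega
  obtain ⟨c, hc⟩ : ∃ c, c ∉ ({a, b} : Finset D) := by
    by_contra! h
    have := (Finset.card_le_card fun d _ => h d : Finset.univ.card ≤ _).trans Finset.card_le_two
    rw [Finset.card_univ] at this
    omega
  simp only [Finset.mem_singleton, Finset.mem_insert, not_or] at hba hc
  obtain ⟨hca, hcb⟩ := hc
  have hb := hpos b
  -- Shrink the mass at `b` by the factor `exp (-s)` and move the excess to `c`.
  set s : ℝ := |M| / pold b + 2 with hs
  have hs0 : 0 < s := by positivity
  set t : ℝ := pold b * Real.exp (-s) with ht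
  have ht0 : 0 < t := by positivity
  have htb : t < pold b := mul_lt_of_lt_one_right hb (Real.exp_lt_one_iff.mpr (by linarith))
  let p : D → ℝ := fun d =>
    pold d + (if d = c then pold b - t else 0) - (if d = b then pold b - t else 0)
  have hpb : p b = t := by simp [p, Ne.symm hcb]
  have hp : ∀ d, 0 < p d := by
    intro d
    by_cases hdb : d = b
    · rwa [hdb, hpb]
    · have := hpos d
      simp only [p, hdb, if_false, sub_zero]
      split_ifs <;> linarith
  have hpsum : ∑ d, p d = 1 := by
    simp [p, Finset.sum_add_distrib, Finset.sum_sub_distrib, hsum]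
  have hpa : p a / pold a = 1 := by
    simp [p, Ne.symm hca, Ne.symm hba, (hpos a).ne']
  refine ⟨p, hp, hpsum, by linarith [hε.1], by linarith [hε.1], ?_⟩
  have hterm : ∀ d, pold d - p d + (if d = b then pold b * (s - 1) else 0)
      ≤ pold d * Real.log (pold d / p d) := by
    intro d
    by_cases hdb : d = b
    · have hlog : Real.log (pold b / t) = s := by
        rw [ht, div_mul_cancel_left₀ hb.ne', ← Real.exp_neg, neg_neg, Real.log_exp]
      rw [hdb, hpb, hlog, if_pos rfl]
      linarith
    · simpa [hdb] using sub_le_mul_log_div (hpos d) (hp d)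
  have hkl := Finset.sum_le_sum fun d (_ : d ∈ Finset.univ) => hterm d
  rw [Finset.sum_add_distrib, Finset.sum_sub_distrib, hsum, hpsum, Finset.sum_ite_eq',
    if_pos (Finset.mem_univ b)] at hkl
  have hval : pold b * (s - 1) = |M| + pold b := by
    rw [hs]
    field_simp
    ring
  linarith [le_abs_self M]
end

section
/- Let μ₀ ∈ ℝ, σ₀ > 0, a ∈ ℝ, and ε ∈ (0,1). Then the KL divergence over the likelihood-ratio-constrained set of one-dimensional Gaussians is unbounded above: for every M ∈ ℝ there exist μ ∈ ℝ and σ > 0 such that 1−ε ≤ N(a|μ,σ)/N(a|μ₀,σ₀) ≤ 1+ε and the KL divergence of the Gaussian measure with mean μ₀ and variance σ₀² from the Gaussian measure with mean μ and variance σ², namely log(σ/σ₀) + (σ₀² + (μ−μ₀)²)/(2σ²) − 1/2, exceeds M. -/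
/-- Gaussian density with mean μ and standard deviation σ. -/
noncomputable def gaussDensity (a μ σ : ℝ) : ℝ :=
  (Real.sqrt (2 * Real.pi) * σ)⁻¹ * Real.exp (-(a - μ) ^ 2 / (2 * σ ^ 2))

/-- Narrowing a Gaussian by a factor `s ≥ 1` while moving its mean away from `a` can keep the
density at `a` unchanged. -/
lemma exists_gaussDensity_div_eq (a μ₀ : ℝ) {σ₀ s : ℝ} (hσ₀ : 0 < σ₀) (hs : 1 ≤ s) :
    ∃ μ : ℝ, gaussDensity a μ (σ₀ / s) = gaussDensity a μ₀ σ₀ := by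
  have hs0 : 0 < s := by linarith
  set L : ℝ := Real.log s + (a - μ₀) ^ 2 / (2 * σ₀ ^ 2) with hL
  have hL0 : 0 ≤ L := add_nonneg (Real.log_nonneg hs) (by positivity)
  refine ⟨a + σ₀ / s * Real.sqrt (2 * L), ?_⟩
  have hexp : -(a - (a + σ₀ / s * Real.sqrt (2 * L))) ^ 2 / (2 * (σ₀ / s) ^ 2) =
      -Real.log s + -(a - μ₀) ^ 2 / (2 * σ₀ ^ 2) := by
    have hsq : (a - (a + σ₀ / s * Real.sqrt (2 * L))) ^ 2 = (σ₀ / s) ^ 2 * (2 * L) := by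
      rw [← Real.sq_sqrt (by positivity : 0 ≤ 2 * L), Real.sqrt_sq (Real.sqrt_nonneg _)]
      ring
    rw [hsq, hL]
    field_simp
    ring
  rw [gaussDensity, gaussDensity, hexp, Real.exp_add, Real.exp_neg, Real.exp_log hs0]
  field_simp

/-- A quadratic lower bound for the part of the Gaussian KL divergence that depends only on the
ratio `s` of the standard deviations. -/
lemma sq_sub_one_div_two_le_sq_div_two_sub_log {s : ℝ} (hs : 0 < s) :
    (s - 1) ^ 2 / 2 ≤ s ^ 2 / 2 - Real.log s - 1 / 2 := by
  linarith [Real.log_le_sub_one_of_pos hs]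

/-- The KL divergence between one-dimensional Gaussians is unbounded above over the
PPO likelihood-ratio-constrained set at a fixed action `a`. -/
theorem kl_unbounded_gaussian (μ₀ σ₀ a ε : ℝ) (hσ₀ : 0 < σ₀)
    (hε : ε ∈ Set.Ioo (0 : ℝ) 1) :
    ∀ M : ℝ, ∃ μ σ : ℝ, 0 < σ ∧
      1 - ε ≤ gaussDensity a μ σ / gaussDensity a μ₀ σ₀ ∧
      gaussDensity a μ σ / gaussDensity a μ₀ σ₀ ≤ 1 + ε ∧
      Real.log (σ / σ₀) + (σ₀ ^ 2 + (μ - μ₀) ^ 2) / (2 * σ ^ 2) - 1 / 2 > M := by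
  intro M
  obtain ⟨hε0, -⟩ := hε
  set s : ℝ := |M| + 3 with hs
  have hs1 : 1 ≤ s := by linarith [abs_nonneg M]
  have hs0 : 0 < s := by linarith
  obtain ⟨μ, hμ⟩ := exists_gaussDensity_div_eq a μ₀ hσ₀ hs1
  have hpos : 0 < gaussDensity a μ₀ σ₀ := by
    unfold gaussDensity
    positivity
  refine ⟨μ, σ₀ / s, by positivity, ?_, ?_, ?_⟩
  · rw [hμ, div_self hpos.ne']
    linarith
  · rw [hμ, div_self hpos.ne']
    linarith
  · have hlog : Real.log (σ₀ / s / σ₀) = -Real.log s := by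
      rw [← Real.log_inv]
      congr 1
      field_simp
    have hquad : s ^ 2 / 2 ≤ (σ₀ ^ 2 + (μ - μ₀) ^ 2) / (2 * (σ₀ / s) ^ 2) := by
      calc s ^ 2 / 2 = σ₀ ^ 2 / (2 * (σ₀ / s) ^ 2) := by field_simp
        _ ≤ _ := by
          gcongr
          exact le_add_of_nonneg_right (sq_nonneg _)
    have hM : M < (s - 1) ^ 2 / 2 := by
      nlinarith [le_abs_self M, abs_nonneg M]
    rw [hlog]
    linarith [sq_sub_one_div_two_le_sq_div_two_sub_log hs0]
end

section
/- For all μ₀, μ ∈ ℝ and σ₀, σ > 0, the Kullback–Leibler divergence of the Gaussian measure on ℝ with mean μ₀ and variance σ₀² from the Gaussian measure with mean μ and variance σ² equals log(σ/σ₀) + (σ₀² + (μ−μ₀)²)/(2σ²) − 1/2. -/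
open MeasureTheory ProbabilityTheory

namespace ProbabilityTheory

/-- The density of a Gaussian measure with respect to a nondegenerate one is the quotient of
their densities. -/
lemma rnDeriv_gaussianReal_gaussianReal (m₀ m : ℝ) (v₀ : NNReal) {v : NNReal} (hv : v ≠ 0) :
    (gaussianReal m₀ v₀).rnDeriv (gaussianReal m v) =ᵐ[volume]
      fun x ↦ (gaussianPDF m v x)⁻¹ * gaussianPDF m₀ v₀ x := by
  rw [gaussianReal_of_var_ne_zero m hv]
  filter_upwards [Measure.rnDeriv_withDensity_right (gaussianReal m₀ v₀) volume
    (measurable_gaussianPDF m v).aemeasurable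
    (ae_of_all _ fun x ↦ (gaussianPDF_pos m hv x).ne')
    (ae_of_all _ fun x ↦ gaussianPDF_ne_top), rnDeriv_gaussianReal m₀ v₀] with x h h₀
  rw [h, h₀]

lemma log_gaussianPDFReal (m : ℝ) {v : NNReal} (hv : v ≠ 0) (x : ℝ) :
    Real.log (gaussianPDFReal m v x) =
      -(Real.log (2 * Real.pi) + Real.log v) / 2 - (x - m) ^ 2 / (2 * v) := by
  have hv' : (0 : ℝ) < v := by positivity
  rw [gaussianPDFReal, Real.log_mul (by positivity) (Real.exp_pos _).ne', Real.log_exp,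
    Real.log_inv, Real.log_sqrt (by positivity), Real.log_mul (by positivity) hv'.ne']
  ring

lemma integrable_sub_sq_gaussianReal (m : ℝ) (v : NNReal) (a : ℝ) :
    Integrable (fun x ↦ (x - a) ^ 2) (gaussianReal m v) :=
  ((memLp_id_gaussianReal 2).sub (memLp_const a)).integrable_sq

lemma integral_sub_sq_gaussianReal (m : ℝ) (v : NNReal) (a : ℝ) :
    ∫ x, (x - a) ^ 2 ∂gaussianReal m v = v + (a - m) ^ 2 := by
  have hL : MemLp (fun x : ℝ ↦ x - a) 2 (gaussianReal m v) :=
    (memLp_id_gaussianReal 2).sub (memLp_const a)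
  have hx : Integrable (fun x : ℝ ↦ x) (gaussianReal m v) :=
    (memLp_id_gaussianReal 1).integrable le_rfl
  have hmean : ∫ x, (x - a) ∂gaussianReal m v = m - a := by
    rw [integral_sub hx (integrable_const a), integral_id_gaussianReal]
    simp
  have h := variance_eq_sub hL
  rw [variance_sub_const (by fun_prop), variance_fun_id_gaussianReal, hmean] at h
  simp only [Pi.pow_apply] at h
  linarith

/-- The log-likelihood ratio of two nondegenerate Gaussian measures. -/
lemma llr_gaussianReal (m₀ m : ℝ) {v₀ v : NNReal} (hv₀ : v₀ ≠ 0) (hv : v ≠ 0) :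
    llr (gaussianReal m₀ v₀) (gaussianReal m v) =ᵐ[gaussianReal m₀ v₀]
      fun x ↦ (Real.log v - Real.log v₀) / 2 +
        ((x - m) ^ 2 / (2 * v) - (x - m₀) ^ 2 / (2 * v₀)) := by
  filter_upwards [(gaussianReal_absolutelyContinuous m₀ hv₀).ae_le
    (rnDeriv_gaussianReal_gaussianReal m₀ m v₀ hv)] with x hx
  rw [llr, hx, ENNReal.toReal_mul, ENNReal.toReal_inv, toReal_gaussianPDF, toReal_gaussianPDF,
    Real.log_mul (inv_ne_zero (gaussianPDFReal_pos m v x hv).ne')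
      (gaussianPDFReal_pos m₀ v₀ x hv₀).ne',
    Real.log_inv, log_gaussianPDFReal m hv, log_gaussianPDFReal m₀ hv₀]
  ring

lemma integral_llr_gaussianReal (m₀ m : ℝ) {v₀ v : NNReal} (hv₀ : v₀ ≠ 0) (hv : v ≠ 0) :
    ∫ x, llr (gaussianReal m₀ v₀) (gaussianReal m v) x ∂gaussianReal m₀ v₀ =
      (Real.log v - Real.log v₀) / 2 + (v₀ + (m - m₀) ^ 2) / (2 * v) - 1 / 2 := by
  have h := (integrable_sub_sq_gaussianReal m₀ v₀ m).div_const (2 * (v : ℝ))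
  have h₀ := (integrable_sub_sq_gaussianReal m₀ v₀ m₀).div_const (2 * (v₀ : ℝ))
  have hv₀' : (v₀ : ℝ) ≠ 0 := by exact_mod_cast hv₀
  rw [integral_congr_ae (llr_gaussianReal m₀ m hv₀ hv),
    integral_add (integrable_const _) (by exact h.sub h₀), integral_sub h h₀]
  simp only [integral_div, integral_sub_sq_gaussianReal, integral_const, probReal_univ, one_smul]
  field_simp
  ring

end ProbabilityTheory

/-- The Kullback–Leibler divergence `∫ log(dP/dQ) dP` of the Gaussian measure with mean μ₀
and variance σ₀² from the Gaussian measure with mean μ and variance σ² equals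
`log(σ/σ₀) + (σ₀² + (μ−μ₀)²)/(2σ²) − 1/2`. -/
theorem kl_gaussian_formula (μ₀ μ σ₀ σ : ℝ) (hσ₀ : 0 < σ₀) (hσ : 0 < σ) :
    ∫ x, Real.log
        (((gaussianReal μ₀ ⟨σ₀ ^ 2, sq_nonneg σ₀⟩).rnDeriv
          (gaussianReal μ ⟨σ ^ 2, sq_nonneg σ⟩) x).toReal)
        ∂(gaussianReal μ₀ ⟨σ₀ ^ 2, sq_nonneg σ₀⟩) =
      Real.log (σ / σ₀) + (σ₀ ^ 2 + (μ - μ₀) ^ 2) / (2 * σ ^ 2) - 1 / 2 := by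
  have hv₀ : (⟨σ₀ ^ 2, sq_nonneg σ₀⟩ : NNReal) ≠ 0 :=
    fun h ↦ (pow_pos hσ₀ 2).ne' (congrArg NNReal.toReal h)
  have hv : (⟨σ ^ 2, sq_nonneg σ⟩ : NNReal) ≠ 0 :=
    fun h ↦ (pow_pos hσ 2).ne' (congrArg NNReal.toReal h)
  refine (integral_llr_gaussianReal μ₀ μ hv₀ hv).trans ?_
  change (Real.log (σ ^ 2) - Real.log (σ₀ ^ 2)) / 2 + (σ₀ ^ 2 + (μ - μ₀) ^ 2) / (2 * σ ^ 2) - 1 / 2 = _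
  rw [Real.log_div hσ.ne' hσ₀.ne', Real.log_pow, Real.log_pow]
  push_cast
  ring
end

section
/- Let ε ∈ (0,1), α > 0, r ∈ ℝ, and A ∈ ℝ. Then the per-sample rollback objective min(r·A, F^RB(r,ε,α)·A) equals F^RB(r,ε,α)·A = (−α·r + (1+α)(1−ε))·A if r ≤ 1−ε and A < 0; equals F^RB(r,ε,α)·A = (−α·r + (1+α)(1+ε))·A if r ≥ 1+ε and A > 0; and equals r·A in all other cases. -/
theorem FRB_of_le {r ε α : ℝ} (h : r ≤ 1 - ε) :
    FRB r ε α = -α * r + (1 + α) * (1 - ε) :=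
  if_pos h

theorem FRB_of_ge {r ε α : ℝ} (hε : 0 < ε) (h : 1 + ε ≤ r) :
    FRB r ε α = -α * r + (1 + α) * (1 + ε) := by
  rw [FRB, if_neg (by linarith), if_pos h]

theorem le_FRB_of_le {r ε α : ℝ} (hα : 0 < α) (h : r ≤ 1 - ε) : r ≤ FRB r ε α := by
  rw [FRB_of_le h]
  nlinarith

theorem FRB_le_of_ge {r ε α : ℝ} (hε : 0 < ε) (hα : 0 < α) (h : 1 + ε ≤ r) :
    FRB r ε α ≤ r := by
  rw [FRB_of_ge hε h]
  nlinarith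

/-- Case form of the per-sample rollback objective `min(r·A, F^RB(r,ε,α)·A)`. -/
theorem rollback_per_sample_cases (ε α r A : ℝ) (hε : ε ∈ Set.Ioo (0 : ℝ) 1)
    (hα : 0 < α) :
    (r ≤ 1 - ε ∧ A < 0 →
      min (r * A) (FRB r ε α * A) = (-α * r + (1 + α) * (1 - ε)) * A) ∧
    (1 + ε ≤ r ∧ 0 < A →
      min (r * A) (FRB r ε α * A) = (-α * r + (1 + α) * (1 + ε)) * A) ∧
    (¬(r ≤ 1 - ε ∧ A < 0) ∧ ¬(1 + ε ≤ r ∧ 0 < A) →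
      min (r * A) (FRB r ε α * A) = r * A) := by
  refine ⟨?_, ?_, ?_⟩
  · rintro ⟨hr, hA⟩
    rw [← FRB_of_le hr]
    exact min_eq_right (mul_le_mul_of_nonpos_right (le_FRB_of_le hα hr) hA.le)
  · rintro ⟨hr, hA⟩
    rw [← FRB_of_ge hε.1 hr]
    exact min_eq_right (mul_le_mul_of_nonneg_right (FRB_le_of_ge hε.1 hα hr) hA.le)
  · rintro ⟨hlow, hhigh⟩
    apply min_eq_left
    by_cases hr : r ≤ 1 - ε
    · have hA : 0 ≤ A := not_lt.mp fun hA => hlow ⟨hr, hA⟩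
      exact mul_le_mul_of_nonneg_right (le_FRB_of_le hα hr) hA
    by_cases hr' : 1 + ε ≤ r
    · have hA : A ≤ 0 := not_lt.mp fun hA => hhigh ⟨hr', hA⟩
      exact mul_le_mul_of_nonpos_right (FRB_le_of_ge hε.1 hα hr') hA
    · rw [FRB, if_neg hr, if_neg hr']
end

section
/- Let ε ∈ (0,1), α > 0, A ∈ ℝ with A ≠ 0, and let r ∈ ℝ satisfy |r − 1| > ε. Then the per-sample rollback objective is strictly smaller at r than at the projection of r onto the clipping range: L^RB_α(r) < L^RB_α(clip(r,ε)), where L^RB_α(r) = min(r·A, F^RB(r,ε,α)·A) and clip(r,ε) = max(1−ε, min(1+ε, r)). -/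
/-- Per-sample rollback objective. -/
noncomputable def LRB1 (ε α A r : ℝ) : ℝ := min (r * A) (FRB r ε α * A)

theorem FRB_one_sub (ε α : ℝ) : FRB (1 - ε) ε α = 1 - ε := by
  rw [FRB, if_pos le_rfl]
  ring

theorem FRB_one_add {ε : ℝ} (hε : 0 < ε) (α : ℝ) : FRB (1 + ε) ε α = 1 + ε := by
  rw [FRB, if_neg (by linarith), if_pos le_rfl]
  ring

theorem one_sub_lt_FRB {ε α r : ℝ} (hα : 0 < α) (hr : r < 1 - ε) : 1 - ε < FRB r ε α := by
  rw [FRB, if_pos hr.le]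
  nlinarith

theorem FRB_lt_one_add {ε α r : ℝ} (hε : 0 < ε) (hα : 0 < α) (hr : 1 + ε < r) :
    FRB r ε α < 1 + ε := by
  rw [FRB, if_neg (by linarith), if_pos hr.le]
  nlinarith

/-- If `c` lies strictly between `a` and `b`, then scaling by `A ≠ 0` puts one of them strictly
below `c`. -/
theorem min_mul_lt_mul_of_lt_of_lt {a b c A : ℝ} (hA : A ≠ 0) (hac : a < c) (hcb : c < b) :
    min (a * A) (b * A) < c * A := by
  rcases hA.lt_or_gt with hA | hA
  · exact min_lt_of_right_lt (mul_lt_mul_of_neg_right hcb hA)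
  · exact min_lt_of_left_lt (mul_lt_mul_of_pos_right hac hA)

/-- The per-sample rollback objective is strictly smaller at an out-of-range ratio than at
its projection onto the clipping range. -/
theorem rollback_lt_at_projection (ε α A r : ℝ) (hε : ε ∈ Set.Ioo (0 : ℝ) 1)
    (hα : 0 < α) (hA : A ≠ 0) (hr : ε < |r - 1|) :
    LRB1 ε α A r < LRB1 ε α A (ppoClip r ε) := by
  have hε0 : 0 < ε := hε.1
  rcases lt_abs.mp hr with h | h
  · have hc : ppoClip r ε = 1 + ε := by
      rw [ppoClip, min_eq_left (by linarith), max_eq_right (by linarith)]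
    rw [hc, LRB1, LRB1, FRB_one_add hε0, min_self, min_comm]
    exact min_mul_lt_mul_of_lt_of_lt hA (FRB_lt_one_add hε0 hα (by linarith)) (by linarith)
  · have hc : ppoClip r ε = 1 - ε := by
      rw [ppoClip, min_eq_right (by linarith), max_eq_left (by linarith)]
    rw [hc, LRB1, LRB1, FRB_one_sub, min_self]
    exact min_mul_lt_mul_of_lt_of_lt hA (by linarith) (one_sub_lt_FRB hα (by linarith))
end

section
/- Let S and 𝒜 be nonempty finite types, let ρ : S → ℝ satisfy ρ(s) > 0 for all s, let π_old assign to each s ∈ S a strictly positive probability vector π_old(·|s) on 𝒜, let Adv : S × 𝒜 → ℝ, and let α ≥ 0. For a strictly positive policy π define M(π) = Σ_s ρ(s)·Σ_a π(a|s)·Adv(s,a) − α·max_{s∈S} Σ_a π_old(a|s)·log(π_old(a|s)/π(a|s)). If π* is a strictly positive policy with M(π*) ≥ M(π) for every strictly positive policy π, then for every state s: Σ_a π*(a|s)·Adv(s,a) ≥ Σ_a π_old(a|s)·Adv(s,a). -/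
/-- The KL-penalized surrogate objective with state weights `ρ`, advantages `Adv`, and
penalty coefficient `α` on the maximum per-state KL divergence. -/
noncomputable def Mobj {S 𝒜 : Type*} [Fintype S] [Fintype 𝒜] [Nonempty S]
    (ρ : S → ℝ) (πold : S → 𝒜 → ℝ) (Adv : S → 𝒜 → ℝ) (α : ℝ)
    (π : S → 𝒜 → ℝ) : ℝ :=
  (∑ s, ρ s * ∑ a, π s a * Adv s a) -
    α * (Finset.univ.sup' Finset.univ_nonempty fun s =>
      ∑ a, πold s a * Real.log (πold s a / π s a))

/-- Gibbs' inequality: the Kullback-Leibler divergence between strictly positive vectors of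
equal total mass is nonnegative. -/
theorem sum_mul_log_div_nonneg {ι : Type*} [Fintype ι] {p q : ι → ℝ}
    (hp : ∀ i, 0 < p i) (hq : ∀ i, 0 < q i) (hpq : ∑ i, p i = ∑ i, q i) :
    0 ≤ ∑ i, p i * Real.log (p i / q i) := by
  have h : ∀ i, p i - q i ≤ p i * Real.log (p i / q i) := fun i => by
    have h1 := Real.one_sub_inv_le_log_of_pos (div_pos (hp i) (hq i))
    calc p i - q i = p i * (1 - (p i / q i)⁻¹) := by
          have := (hp i).ne'
          field_simp
      _ ≤ _ := mul_le_mul_of_nonneg_left h1 (hp i).le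
  calc (0 : ℝ) = ∑ i, (p i - q i) := by rw [Finset.sum_sub_distrib, hpq, sub_self]
    _ ≤ _ := Finset.sum_le_sum fun i _ => h i

/-- Any strictly positive policy maximizing the KL-penalized surrogate objective improves
the per-state expected advantage over the old policy at every state. -/
theorem maximizer_improves_every_state (S 𝒜 : Type*) [Fintype S] [Fintype 𝒜]
    [Nonempty S] [Nonempty 𝒜]
    (ρ : S → ℝ) (hρ : ∀ s, 0 < ρ s)
    (πold : S → 𝒜 → ℝ) (hpold : ∀ s a, 0 < πold s a)
    (hsumold : ∀ s, ∑ a, πold s a = 1)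
    (Adv : S → 𝒜 → ℝ) (α : ℝ) (hα : 0 ≤ α)
    (πstar : S → 𝒜 → ℝ) (hpos : ∀ s a, 0 < πstar s a)
    (hsum : ∀ s, ∑ a, πstar s a = 1)
    (hopt : ∀ π : S → 𝒜 → ℝ, (∀ s a, 0 < π s a) → (∀ s, ∑ a, π s a = 1) →
      Mobj ρ πold Adv α π ≤ Mobj ρ πold Adv α πstar) :
    ∀ s, ∑ a, πold s a * Adv s a ≤ ∑ a, πstar s a * Adv s a := by
  classical
  intro s
  by_contra! hlt
  set π := Function.update πstar s (πold s)
  have hπs : π s = πold s := Function.update_self ..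
  have hπne : ∀ t, t ≠ s → π t = πstar t := fun t ht => Function.update_of_ne ht ..
  have hπ_pos : ∀ t a, 0 < π t a := fun t a => by
    rcases eq_or_ne t s with rfl | ht
    · exact hπs ▸ hpold t a
    · exact hπne t ht ▸ hpos t a
  have hπ_sum : ∀ t, ∑ a, π t a = 1 := fun t => by
    rcases eq_or_ne t s with rfl | ht
    · exact hπs ▸ hsumold t
    · exact hπne t ht ▸ hsum t
  have hgain : ∑ t, ρ t * ∑ a, πstar t a * Adv t a < ∑ t, ρ t * ∑ a, π t a * Adv t a := by
    refine Finset.sum_lt_sum (fun t _ => ?_) ⟨s, Finset.mem_univ s, ?_⟩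
    · rcases eq_or_ne t s with rfl | ht
      · rw [hπs]
        exact mul_le_mul_of_nonneg_left hlt.le (hρ t).le
      · rw [hπne t ht]
    · rw [hπs]
      exact mul_lt_mul_of_pos_left hlt (hρ s)
  have hpenalty : (Finset.univ.sup' Finset.univ_nonempty fun t =>
        ∑ a, πold t a * Real.log (πold t a / π t a)) ≤
      Finset.univ.sup' Finset.univ_nonempty fun t =>
        ∑ a, πold t a * Real.log (πold t a / πstar t a) := by
    refine Finset.sup'_mono_fun fun t _ => ?_
    rcases eq_or_ne t s with rfl | ht
    · simpa [hπs, div_self (hpold t _).ne'] using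
        sum_mul_log_div_nonneg (hpold t) (hpos t) ((hsumold t).trans (hsum t).symm)
    · rw [hπne t ht]
  have hle := hopt π hπ_pos hπ_sum
  unfold Mobj at hle
  linarith [mul_le_mul_of_nonneg_left hpenalty hα]
end

section
/- Let S and 𝒜 be nonempty finite types, let ρ : S → ℝ satisfy ρ(s) > 0 for all s, let π_old assign to each s ∈ S a strictly positive probability vector π_old(·|s) on 𝒜, let Adv : S × 𝒜 → ℝ, and let α ≥ 0. If π* is a strictly positive policy maximizing M(π) = Σ_s ρ(s)·Σ_a π(a|s)·Adv(s,a) − α·max_{s∈S} Σ_a π_old(a|s)·log(π_old(a|s)/π(a|s)) over all strictly positive policies, then for every state s there exists an action a ∈ 𝒜 with π*(a|s)·Adv(s,a) ≥ π_old(a|s)·Adv(s,a); equivalently, the likelihood ratio r(s,a) = π*(a|s)/π_old(a|s) satisfies r(s,a)·Adv(s,a) ≥ Adv(s,a). -/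
/-- Resetting one state of a policy to the old policy strictly increases the surrogate
objective if it strictly increases the expected advantage at that state. -/
theorem Mobj_lt_Mobj_update {S 𝒜 : Type*} [Fintype S] [Fintype 𝒜] [Nonempty S]
    [DecidableEq S] {ρ : S → ℝ} {πold Adv π : S → 𝒜 → ℝ} {α : ℝ} (hα : 0 ≤ α) {s : S}
    (hρ : 0 < ρ s) (hpold : ∀ a, 0 < πold s a) (hpos : ∀ a, 0 < π s a)
    (hsum : ∑ a, πold s a = ∑ a, π s a)
    (hlt : ∑ a, π s a * Adv s a < ∑ a, πold s a * Adv s a) :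
    Mobj ρ πold Adv α π < Mobj ρ πold Adv α (Function.update π s (πold s)) := by
  refine (sub_lt_sub_right
    (Finset.sum_lt_sum (fun t _ => ?_) ⟨s, Finset.mem_univ s, ?_⟩) _).trans_le
    (sub_le_sub_left (mul_le_mul_of_nonneg_left (Finset.sup'_mono_fun fun t _ => ?_) hα) _)
  · rcases eq_or_ne t s with rfl | ht
    · simpa using mul_le_mul_of_nonneg_left hlt.le hρ.le
    · simp [ht]
  · simpa using mul_lt_mul_of_pos_left hlt hρ
  · rcases eq_or_ne t s with rfl | ht
    · simpa [fun a => div_self (hpold a).ne'] using sum_mul_log_div_nonneg hpold hpos hsum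
    · simp [ht]

/-- For any strictly positive policy maximizing the KL-penalized surrogate objective, at
every state there is an action whose weighted advantage is improved over the old policy;
equivalently, the likelihood ratio `r(s,a) = π*(a|s)/π_old(a|s)` satisfies
`r(s,a)·Adv(s,a) ≥ Adv(s,a)`. -/
theorem maximizer_has_improving_action (S 𝒜 : Type*) [Fintype S] [Fintype 𝒜]
    [Nonempty S] [Nonempty 𝒜]
    (ρ : S → ℝ) (hρ : ∀ s, 0 < ρ s)
    (πold : S → 𝒜 → ℝ) (hpold : ∀ s a, 0 < πold s a)
    (hsumold : ∀ s, ∑ a, πold s a = 1)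
    (Adv : S → 𝒜 → ℝ) (α : ℝ) (hα : 0 ≤ α)
    (πstar : S → 𝒜 → ℝ) (hpos : ∀ s a, 0 < πstar s a)
    (hsum : ∀ s, ∑ a, πstar s a = 1)
    (hopt : ∀ π : S → 𝒜 → ℝ, (∀ s a, 0 < π s a) → (∀ s, ∑ a, π s a = 1) →
      Mobj ρ πold Adv α π ≤ Mobj ρ πold Adv α πstar) :
    ∀ s, ∃ a, πold s a * Adv s a ≤ πstar s a * Adv s a ∧
      Adv s a ≤ (πstar s a / πold s a) * Adv s a := by
  classical
  intro s
  obtain ⟨a, ha⟩ : ∃ a, πold s a * Adv s a ≤ πstar s a * Adv s a := by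
    by_contra! h
    refine (Mobj_lt_Mobj_update hα (hρ s) (hpold s) (hpos s) ((hsumold s).trans (hsum s).symm)
      (Finset.sum_lt_sum_of_nonempty Finset.univ_nonempty fun a _ => h a)).not_ge
      (hopt _ (fun t => ?_) fun t => ?_) <;>
    rcases eq_or_ne t s with rfl | ht
    · simpa using hpold t
    · simpa [ht] using hpos t
    · simpa using hsumold t
    · simpa [ht] using hsum t
  refine ⟨a, ha, ?_⟩
  rwa [div_mul_eq_mul_div, le_div_iff₀ (hpold s a), mul_comm]
end
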